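/- Let n ≥ 1 and fix real numbers c_σ for each permutation σ of {1, …, n}. Let F be any finite field with q elements, and let φ be the arithmetic function of von Mangoldt type on M_n(F) associated to the coefficients (c_σ)_σ. Then Σ_{f ∈ M_n(F)} φ(f) = ( Σ_σ c_σ ) · q^n. -/

import Mathlib

open scoped Classical

/-- The monic polynomial `X ^ n + ∑_{j < n} c j * X ^ j`; as `c` ranges over `Fin n → F`
this enumerates the monic polynomials of degree `n` exactly once. -/
noncomputable def monicOfCoeffs {F : Type*} [Field F] (n : ℕ) (c : Fin n → F) : Polynomial F :=
  Polynomial.X ^ n + ∑ j : Fin n, Polynomial.C (c j) * Polynomial.X ^ (j : ℕ)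

/-- The arithmetic function of von Mangoldt type on monic degree-`n` polynomials over the
finite field `F` with `q` elements associated to real coefficients `(c σ)σ`:
`φ f = ∑_{z ∈ K^n, f = ∏ (x - z j)} ∑ σ, c σ • δ_σ z`, where `K` is an algebraic closure of
`F` and `δ_σ z = 1` if `z j ^ q = z (σ j)` for all `j`, and `0` otherwise. -/
noncomputable def vonMangoldtType (F : Type*) [Field F] [Fintype F] (n : ℕ)
    (c : Equiv.Perm (Fin n) → ℝ) (f : Polynomial F) : ℝ :=
  ∑ᶠ z : Fin n → AlgebraicClosure F,
    if Polynomial.map (algebraMap F (AlgebraicClosure F)) f =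
        ∏ j : Fin n, (Polynomial.X - Polynomial.C (z j)) then
      ∑ σ : Equiv.Perm (Fin n), c σ *
        (if ∀ j, z j ^ Fintype.card F = z (σ j) then 1 else 0)
    else 0

theorem exists_algebraMap_eq_of_pow_card_eq {E K : Type*} [Field E] [Fintype E] [Field K]
    [Algebra E K] {x : K} (hx : x ^ Fintype.card E = x) : ∃ a : E, algebraMap E K a = x := by
  have hsplit : (Polynomial.X ^ Fintype.card E - Polynomial.X : Polynomial E) =
      ∏ a : E, (Polynomial.X - Polynomial.C a) := by
    have hdeg := FiniteField.X_pow_card_sub_X_natDegree_eq E (Fintype.one_lt_card (α := E))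
    have hmonic : (Polynomial.X ^ Fintype.card E - Polynomial.X : Polynomial E).Monic :=
      Polynomial.monic_X_pow_sub (by
        rw [Polynomial.degree_X]; exact_mod_cast Fintype.one_lt_card (α := E))
    have h := Polynomial.prod_multiset_X_sub_C_of_monic_of_roots_card_eq hmonic (by
      rw [FiniteField.roots_X_pow_card_sub_X, hdeg]; rfl)
    rw [FiniteField.roots_X_pow_card_sub_X] at h
    exact h.symm
  have h := congrArg (Polynomial.aeval x) hsplit
  simp only [map_sub, map_pow, Polynomial.aeval_X, hx, sub_self, map_prod,
    Polynomial.aeval_C] at h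
  obtain ⟨a, -, ha⟩ := Finset.prod_eq_zero_iff.mp h.symm
  exact ⟨a, (sub_eq_zero.mp ha).symm⟩

/-- A normal basis of `L/F` identifies the tuples whose Frobenius twist is the permutation `σ`
with functions `ι → F`. -/
theorem card_pow_card_eq_perm_of_orderOf_dvd {F L ι : Type*} [Field F] [Fintype F] [Field L]
    [Finite L] [Algebra F L] [Fintype ι] (σ : Equiv.Perm ι)
    (hσ : orderOf σ ∣ Module.finrank F L) :
    Nat.card {z : ι → L // ∀ j, z j ^ Fintype.card F = z (σ j)} =
      Fintype.card F ^ Fintype.card ι := by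
  have : Module.Finite F L := Module.Finite.of_finite
  set φ : Gal(L/F) := FiniteField.frobeniusAlgEquivOfAlgebraic F L with hφ
  have hφ_apply (x : L) : φ x = x ^ Fintype.card F := rfl
  have hgen (g : Gal(L/F)) : g ∈ Subgroup.zpowers φ := by
    obtain ⟨i, hi⟩ := (FiniteField.bijective_frobeniusAlgEquivOfAlgebraic_pow F L).2 g
    exact ⟨i, by simpa using hi⟩
  have hord : orderOf σ ∣ orderOf φ := by
    rwa [hφ, FiniteField.orderOf_frobeniusAlgEquivOfAlgebraic]
  let ρ : Gal(L/F) →* Equiv.Perm ι := monoidHomOfForallMemZpowers hgen hord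
  have hρ : ρ φ = σ := monoidHomOfForallMemZpowers_apply_gen hgen hord
  let b := IsGalois.normalBasis F L
  have hb (g h : Gal(L/F)) : g (b h) = b (g * h) := by
    simp only [b]
    rw [IsGalois.normalBasis_apply h, IsGalois.normalBasis_apply (g * h), AlgEquiv.mul_apply]
  have hrepr (g h : Gal(L/F)) (x : L) : b.repr (g x) h = b.repr x (g⁻¹ * h) := by
    have hx : g x = ∑ k, b.repr x (g⁻¹ * k) • b k := by
      conv_lhs => rw [← b.sum_repr x]
      conv_rhs => rw [← Equiv.sum_comp (Equiv.mulLeft g)]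
      rw [map_sum]
      simp [hb]
    rw [hx, b.repr_sum_self]
  have key (z : ι → L) (hz : ∀ j, z j ^ Fintype.card F = z (σ j)) (g : Gal(L/F)) (j : ι) :
      g (z j) = z (ρ g j) := by
    obtain ⟨i, hi⟩ := (FiniteField.bijective_frobeniusAlgEquivOfAlgebraic_pow F L).2 g
    replace hi : φ ^ (i : ℕ) = g := hi
    rw [← hi, map_pow, hρ]
    generalize (i : ℕ) = m
    induction m generalizing j with
    | zero => simp
    | succ m ih =>
      rw [pow_succ, pow_succ, AlgEquiv.mul_apply, Equiv.Perm.mul_apply, hφ_apply, hz, ih]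
  let e : {z : ι → L // ∀ j, z j ^ Fintype.card F = z (σ j)} ≃ (ι → F) :=
    { toFun := fun z j ↦ b.repr (z.1 j) 1
      invFun := fun a ↦ ⟨fun j ↦ ∑ g, a ((ρ g)⁻¹ j) • b g, fun j ↦ by
        beta_reduce
        conv_rhs => rw [← Equiv.sum_comp (Equiv.mulLeft φ)]
        rw [← hφ_apply, map_sum]
        simp [hb, hρ]⟩
      left_inv := fun z ↦ by
        ext j
        simp only
        rw [← b.sum_repr (z.1 j)]
        refine Finset.sum_congr rfl fun g _ ↦ ?_
        rw [← map_inv, ← key z.1 z.2, hrepr]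
        simp
      right_inv := fun a ↦ by
        ext j
        simp only
        rw [b.repr_sum_self]
        simp }
  rw [Nat.card_congr e, Nat.card_eq_fintype_card, Fintype.card_fun]

theorem card_pow_card_eq_perm {F K ι : Type*} [Field F] [Fintype F] [Field K] [IsAlgClosed K]
    [Algebra F K] [Fintype ι] (σ : Equiv.Perm ι) :
    Nat.card {z : ι → K // ∀ j, z j ^ Fintype.card F = z (σ j)} =
      Fintype.card F ^ Fintype.card ι := by
  obtain ⟨p, hp⟩ := CharP.exists F
  have : Fact p.Prime := ⟨CharP.char_is_prime F p⟩
  have : NeZero (orderOf σ) := ⟨(orderOf_pos σ).ne'⟩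
  let L := FiniteField.Extension F p (orderOf σ)
  have : Fintype L := Fintype.ofFinite L
  let f : L →ₐ[F] K := IsAlgClosed.lift
  algebraize [f.toRingHom]
  have hcard : Fintype.card L = Fintype.card F ^ orderOf σ := by
    rw [← Nat.card_eq_fintype_card, ← Nat.card_eq_fintype_card]
    exact FiniteField.natCard_extension F p (orderOf σ)
  rw [← card_pow_card_eq_perm_of_orderOf_dvd (F := F) (L := L) σ
    (FiniteField.finrank_extension F p (orderOf σ)).symm.dvd]
  symm
  refine Nat.card_congr (Equiv.ofBijective
    (fun z ↦ ⟨fun j ↦ f (z.1 j), fun j ↦ by rw [← map_pow, z.2]⟩) ⟨fun z w h ↦ ?_, fun z ↦ ?_⟩)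
  · ext j
    exact f.injective (congrFun (Subtype.ext_iff.mp h) j)
  · have hpow (m : ℕ) (j : ι) : z.1 j ^ Fintype.card F ^ m = z.1 ((σ ^ m) j) := by
      induction m generalizing j with
      | zero => simp
      | succ m ih => rw [pow_succ', pow_mul, z.2, ih, pow_succ, Equiv.Perm.mul_apply]
    have hmem (j : ι) : ∃ a : L, f a = z.1 j :=
      exists_algebraMap_eq_of_pow_card_eq (E := L) (by
        rw [hcard, hpow, pow_orderOf_eq_one, Equiv.Perm.one_apply])
    choose a ha using hmem
    refine ⟨⟨a, fun j ↦ f.injective ?_⟩, ?_⟩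
    · change f (a j ^ Fintype.card F) = f (a (σ j))
      rw [map_pow, ha, ha, z.2]
    · ext j
      exact ha j

theorem coeff_monicOfCoeffs {F : Type*} [Field F] (n : ℕ) (c : Fin n → F) (i : Fin n) :
    (monicOfCoeffs n c).coeff i = c i := by
  simp [monicOfCoeffs, Polynomial.coeff_X_pow, i.2.ne, Polynomial.finsetSum_coeff,
    Fin.val_inj]

theorem existsUnique_map_monicOfCoeffs_eq_prod {F K : Type*} [Field F] [Fintype F] [Field K]
    [Algebra F K] {n : ℕ} {σ : Equiv.Perm (Fin n)} {z : Fin n → K}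
    (hz : ∀ j, z j ^ Fintype.card F = z (σ j)) :
    ∃! co : Fin n → F, Polynomial.map (algebraMap F K) (monicOfCoeffs n co) =
      ∏ j : Fin n, (Polynomial.X - Polynomial.C (z j)) := by
  set P : Polynomial K := ∏ j : Fin n, (Polynomial.X - Polynomial.C (z j)) with hP
  have hmonic : P.Monic := Polynomial.monic_prod_X_sub_C _ _
  have hdeg : P.natDegree = n := by simp [hP]
  have hfrob : P.map (FiniteField.frobeniusAlgHom F K : K →+* K) = P := by
    rw [hP, Polynomial.map_prod]
    conv_rhs => rw [← Equiv.prod_comp σ]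
    simp [hz]
  have hcoeff (i : ℕ) : ∃ a : F, algebraMap F K a = P.coeff i := by
    refine exists_algebraMap_eq_of_pow_card_eq ?_
    conv_rhs => rw [← hfrob, Polynomial.coeff_map]
    rfl
  choose a ha using hcoeff
  refine ⟨fun i ↦ a i, ?_, fun d hd ↦ ?_⟩
  · simp only
    rw [hmonic.as_sum, hdeg, Finset.sum_range]
    simp [monicOfCoeffs, Polynomial.map_sum, ha]
  · ext i
    apply (algebraMap F K).injective
    rw [ha, ← hd, Polynomial.coeff_map, coeff_monicOfCoeffs]

theorem finite_pow_card_eq_perm {F K ι : Type*} [Field F] [Fintype F] [Field K] [IsAlgClosed K]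
    [Algebra F K] [Fintype ι] (σ : Equiv.Perm ι) :
    {z : ι → K | ∀ j, z j ^ Fintype.card F = z (σ j)}.Finite := by
  refine Set.finite_coe_iff.mp (Nat.finite_of_card_ne_zero ?_)
  exact (card_pow_card_eq_perm (F := F) (K := K) σ).trans_ne (pow_pos Fintype.card_pos _).ne'

/-- For any real coefficients `(c σ)σ` and the associated arithmetic
function `φ` of von Mangoldt type on `M_n(F)`, `∑_{f ∈ M_n(F)} φ f = (∑ σ, c σ) * q ^ n`. -/
theorem sum_vonMangoldtType (n : ℕ) (hn : 1 ≤ n) (c : Equiv.Perm (Fin n) → ℝ)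
    (F : Type*) [Field F] [Fintype F] :
    ∑ co : Fin n → F, vonMangoldtType F n c (monicOfCoeffs n co) =
      (∑ σ : Equiv.Perm (Fin n), c σ) * (Fintype.card F : ℝ) ^ n := by
  have hfin : (⋃ σ : Equiv.Perm (Fin n), {z : Fin n → AlgebraicClosure F |
      ∀ j, z j ^ Fintype.card F = z (σ j)}).Finite :=
    Set.finite_iUnion fun σ ↦ finite_pow_card_eq_perm (F := F) σ
  set T := hfin.toFinset with hT
  have hmem (z : Fin n → AlgebraicClosure F) :
      z ∈ T ↔ ∃ σ : Equiv.Perm (Fin n), ∀ j, z j ^ Fintype.card F = z (σ j) := by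
    simp [hT]
  have hsum (co : Fin n → F) : vonMangoldtType F n c (monicOfCoeffs n co) =
      ∑ z ∈ T, ∑ σ : Equiv.Perm (Fin n),
        if ∀ j, z j ^ Fintype.card F = z (σ j) then
          (if Polynomial.map (algebraMap F (AlgebraicClosure F)) (monicOfCoeffs n co) =
            ∏ j : Fin n, (Polynomial.X - Polynomial.C (z j)) then c σ else 0) else 0 := by
    rw [vonMangoldtType, finsum_eq_sum_of_support_subset (s := T)]
    · refine Finset.sum_congr rfl fun z _ ↦ ?_
      split_ifs <;> simp
    · intro z hz
      by_contra hzT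
      refine hz ?_
      simp only [Finset.mem_coe, hmem, not_exists] at hzT
      simp [hzT]
  simp_rw [hsum]
  rw [Finset.sum_comm]
  simp_rw [Finset.sum_comm (s := (Finset.univ : Finset (Fin n → F)))]
  rw [Finset.sum_comm, Finset.sum_mul]
  refine Finset.sum_congr rfl fun σ _ ↦ ?_
  have hinner (z : Fin n → AlgebraicClosure F) :
      (∑ co : Fin n → F, if ∀ j, z j ^ Fintype.card F = z (σ j) then
          (if Polynomial.map (algebraMap F (AlgebraicClosure F)) (monicOfCoeffs n co) =
            ∏ j : Fin n, (Polynomial.X - Polynomial.C (z j)) then c σ else 0) else 0) =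
        if ∀ j, z j ^ Fintype.card F = z (σ j) then c σ else 0 := by
    split_ifs with hz
    · obtain ⟨co, hco, huniq⟩ := existsUnique_map_monicOfCoeffs_eq_prod hz
      rw [Finset.sum_eq_single co (fun d _ hd ↦ if_neg fun h ↦ hd (huniq d h)) (by simp),
        if_pos hco]
    · simp
  simp_rw [hinner]
  rw [← Finset.sum_filter, Finset.sum_const, nsmul_eq_mul, mul_comm]
  congr 1
  have hcard := card_pow_card_eq_perm (F := F) (K := AlgebraicClosure F) σ
  rw [Fintype.card_fin] at hcard
  rw [← Nat.cast_pow, ← hcard, Nat.subtype_card]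
  intro z
  rw [Finset.mem_filter, hmem]
  exact ⟨fun h ↦ h.2, fun h ↦ ⟨⟨σ, h⟩, h⟩⟩
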